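/- arXiv:1707.05232 — 4 statements merged into one kernel-verified Lean document; each statement's English description precedes it below -/
import Mathlib

section
/- Consider the model y = Xβ* + ε with ε ~ N(0, σ²I_n), where β* has support of cardinality s and columns of X satisfy ‖X_j‖₂² = n. Suppose X satisfies RE(3, s), and let λ₁ = ((1+2r)/r)·2σ√(2 log(p/δ)/n) for δ ∈ (0,1), where r = λ₂/λ₁ > 0. Then with probability at least 1 − δ, the Bregman Lasso β̄ = β̂^{λ₁,λ₂} and the Lasso β̂ = β̂^{λ₁} satisfy ((r+2)/r)·(1/n)‖X(β* − β̄)‖₂² + (1/n)‖X(β* − β̂)‖₂² ≤ λ₁²s/κ²(1, s) + 9λ₁²s/(4κ²(3, s)). -/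
open MeasureTheory ProbabilityTheory Finset

noncomputable section

/-- Product Gaussian measure `N(0, σ² I_n)` on `ℝⁿ`. -/
def gaussianVec (n : ℕ) (σ : ℝ) : Measure (Fin n → ℝ) :=
  Measure.pi fun _ => gaussianReal 0 (σ ^ 2).toNNReal

/-- Squared Euclidean norm. -/
def l2sq {m : ℕ} (v : Fin m → ℝ) : ℝ := ∑ i, (v i) ^ 2

/-- Euclidean norm. -/
def l2 {m : ℕ} (v : Fin m → ℝ) : ℝ := Real.sqrt (l2sq v)

/-- ℓ₁ norm. -/
def l1 {m : ℕ} (v : Fin m → ℝ) : ℝ := ∑ i, |v i|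

/-- Lasso objective `(1/2n)‖y − Xβ‖₂² + λ‖β‖₁`. -/
def lassoObj {n p : ℕ} (X : Matrix (Fin n) (Fin p) ℝ) (y : Fin n → ℝ) (lam : ℝ)
    (β : Fin p → ℝ) : ℝ :=
  l2sq (y - X.mulVec β) / (2 * (n : ℝ)) + lam * l1 β

/-- `b` is a Lasso solution with tuning parameter `lam`. -/
def IsLassoSol {n p : ℕ} (X : Matrix (Fin n) (Fin p) ℝ) (y : Fin n → ℝ) (lam : ℝ)
    (b : Fin p → ℝ) : Prop :=
  ∀ β : Fin p → ℝ, lassoObj X y lam b ≤ lassoObj X y lam β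

/-- Restricted eigenvalue condition RE(c₀, s) with constant `κ`:
for every `J` with `|J| ≤ s` and every `Δ` with `‖Δ_{Jᶜ}‖₁ ≤ c₀‖Δ_J‖₁`,
one has `‖XΔ‖₂² ≥ κ² n ‖Δ_J‖₂²`. -/
def RE {n p : ℕ} (X : Matrix (Fin n) (Fin p) ℝ) (c0 : ℝ) (s : ℕ) (κ : ℝ) : Prop :=
  0 < κ ∧ ∀ J : Finset (Fin p), J.card ≤ s → ∀ Δ : Fin p → ℝ,
    (∑ j ∈ Jᶜ, |Δ j|) ≤ c0 * ∑ j ∈ J, |Δ j| →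
    κ ^ 2 * ((n : ℝ) * ∑ j ∈ J, (Δ j) ^ 2) ≤ l2sq (X.mulVec Δ)

/-- The Lasso subgradient `ρ̂ = Xᵀ(y − Xβ̂)/(λ n)`. -/
def lassoSubgrad {n p : ℕ} (X : Matrix (Fin n) (Fin p) ℝ) (y : Fin n → ℝ) (lam : ℝ)
    (b : Fin p → ℝ) : Fin p → ℝ :=
  fun j => (X.transpose.mulVec (y - X.mulVec b)) j / (lam * (n : ℝ))

/-- Boosted Lasso objective `(1/2n)‖y − Xβ‖₂² + λ₂‖β − β̂‖₁`. -/
def boostedObj {n p : ℕ} (X : Matrix (Fin n) (Fin p) ℝ) (y : Fin n → ℝ) (lam2 : ℝ)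
    (bhat β : Fin p → ℝ) : ℝ :=
  l2sq (y - X.mulVec β) / (2 * (n : ℝ)) + lam2 * l1 (β - bhat)

/-- `b` is a Boosted Lasso solution built upon the first-step estimator `bhat`. -/
def IsBoostedSol {n p : ℕ} (X : Matrix (Fin n) (Fin p) ℝ) (y : Fin n → ℝ) (lam2 : ℝ)
    (bhat b : Fin p → ℝ) : Prop :=
  ∀ β : Fin p → ℝ, boostedObj X y lam2 bhat b ≤ boostedObj X y lam2 bhat β

/-- Bregman Lasso objective
`(1/2n)‖y − Xβ‖₂² + λ₂(‖β‖₁ − ⟨ρ̂^{λ₁}, β⟩)` where `ρ̂^{λ₁}` is the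
Lasso subgradient associated with `bhat`. -/
def bregmanObj {n p : ℕ} (X : Matrix (Fin n) (Fin p) ℝ) (y : Fin n → ℝ) (lam1 lam2 : ℝ)
    (bhat β : Fin p → ℝ) : ℝ :=
  l2sq (y - X.mulVec β) / (2 * (n : ℝ)) +
    lam2 * (l1 β - ∑ j, lassoSubgrad X y lam1 bhat j * β j)

/-- `b` is a Bregman Lasso solution with parameters `(lam1, lam2)`. -/
def IsBregmanSol {n p : ℕ} (X : Matrix (Fin n) (Fin p) ℝ) (y : Fin n → ℝ) (lam1 lam2 : ℝ)
    (bhat b : Fin p → ℝ) : Prop :=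
  ∀ β : Fin p → ℝ, bregmanObj X y lam1 lam2 bhat b ≤ bregmanObj X y lam1 lam2 bhat β

/-- `bbar` is a sign-consistent refitting of the Lasso solution `bhat`:
it does not increase the residual norm and `(1/n)Xᵀ(y − Xβ̂) ∈ λ·sign(β̄)`
componentwise. -/
def SignConsistentRefit {n p : ℕ} (X : Matrix (Fin n) (Fin p) ℝ) (y : Fin n → ℝ) (lam : ℝ)
    (bhat bbar : Fin p → ℝ) : Prop :=
  l2 (y - X.mulVec bbar) ≤ l2 (y - X.mulVec bhat) ∧
  ∀ j, (0 < bbar j → X.transpose.mulVec (y - X.mulVec bhat) j / (n : ℝ) = lam) ∧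
       (bbar j < 0 → X.transpose.mulVec (y - X.mulVec bhat) j / (n : ℝ) = -lam) ∧
       (bbar j = 0 → |X.transpose.mulVec (y - X.mulVec bhat) j / (n : ℝ)| ≤ lam)

/-- `bbar` is a Sign-Least-Squares Lasso refitting of the Lasso solution `bhat`:
it vanishes outside the equicorrelation set `E = {j : |ρ̂_j| = 1}` and minimizes
the residual sum of squares among all vectors supported on `E` whose coordinates
have signs compatible with `ρ̂_E`. -/
def IsSLSSol {n p : ℕ} (X : Matrix (Fin n) (Fin p) ℝ) (y : Fin n → ℝ) (lam : ℝ)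
    (bhat bbar : Fin p → ℝ) : Prop :=
  (∀ j, |lassoSubgrad X y lam bhat j| ≠ 1 → bbar j = 0) ∧
  (∀ j, 0 ≤ lassoSubgrad X y lam bhat j * bbar j) ∧
  ∀ β : Fin p → ℝ,
    ((∀ j, |lassoSubgrad X y lam bhat j| ≠ 1 → β j = 0) ∧
     (∀ j, 0 ≤ lassoSubgrad X y lam bhat j * β j)) →
    l2sq (y - X.mulVec bbar) ≤ l2sq (y - X.mulVec β)

/-- Componentwise soft-thresholding operator `softThresh(y, λ)_j = sign(y_j)(|y_j| − λ)₊`. -/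
def softThresh {p : ℕ} (y : Fin p → ℝ) (lam : ℝ) : Fin p → ℝ :=
  fun j => Real.sign (y j) * max (|y j| - lam) 0

/-- Componentwise firm-thresholding (MCP) operator. -/
def MCP {p : ℕ} (y : Fin p → ℝ) (μ γ : ℝ) : Fin p → ℝ :=
  fun j => if |y j| ≤ μ * γ then γ / (γ - 1) * (Real.sign (y j) * max (|y j| - μ) 0) else y j

/-- Bregman objective in the denoising (orthogonal, `X = I_p`) case:
`(1/2)‖y − β‖₂² + λ(‖β‖₁ − ⟨ρ, β⟩)`. -/
def denoiseBregObj {p : ℕ} (y ρ : Fin p → ℝ) (lam : ℝ) (β : Fin p → ℝ) : ℝ :=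
  (1 / 2) * l2sq (y - β) + lam * (l1 β - ∑ j, ρ j * β j)

end

lemma l2sq_eq_dotProduct {m : ℕ} (v : Fin m → ℝ) : l2sq v = v ⬝ᵥ v := by
  simp [l2sq, dotProduct, sq]

lemma convexOn_l1 {m : ℕ} : ConvexOn ℝ Set.univ (l1 : (Fin m → ℝ) → ℝ) := by
  refine ⟨convex_univ, fun x _ y _ a b ha hb _ => ?_⟩
  simp only [l1, smul_eq_mul, mul_sum, ← sum_add_distrib, Pi.add_apply, Pi.smul_apply]
  refine sum_le_sum fun i _ => (abs_add_le _ _).trans_eq ?_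
  rw [abs_mul, abs_mul, abs_of_nonneg ha, abs_of_nonneg hb]

/-- First-order optimality condition for a least-squares objective with a convex penalty. -/
lemma dotProduct_residual_le_of_isMin {n p : ℕ} (hn : 0 < n) (X : Matrix (Fin n) (Fin p) ℝ)
    (y : Fin n → ℝ) {φ : (Fin p → ℝ) → ℝ} (hφ : ConvexOn ℝ Set.univ φ) {b : Fin p → ℝ}
    (hb : ∀ β, l2sq (y - X.mulVec b) / (2 * (n : ℝ)) + φ b ≤
      l2sq (y - X.mulVec β) / (2 * (n : ℝ)) + φ β) (β : Fin p → ℝ) :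
    (y - X.mulVec b) ⬝ᵥ X.mulVec (β - b) / n ≤ φ β - φ b := by
  have hn' : (0 : ℝ) < n := Nat.cast_pos.mpr hn
  set e := y - X.mulVec b with he
  set z := X.mulVec (β - b) with hz
  set c : ℝ := z ⬝ᵥ z / (2 * n) with hc
  have hc0 : 0 ≤ c := by
    rw [hc, ← l2sq_eq_dotProduct]
    exact div_nonneg (sum_nonneg fun i _ => sq_nonneg _) (by positivity)
  have hline : ∀ t : ℝ, 0 < t → t ≤ 1 →
      t * (e ⬝ᵥ z / n - (φ β - φ b)) ≤ t ^ 2 * c := by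
    intro t ht0 ht1
    have hconv := hφ.2 (Set.mem_univ b) (Set.mem_univ β) (sub_nonneg.mpr ht1) ht0.le (by ring)
    have hres : y - X.mulVec ((1 - t) • b + t • β) = e - t • z := by
      rw [he, hz, Matrix.mulVec_add, Matrix.mulVec_smul, Matrix.mulVec_smul, Matrix.mulVec_sub]
      module
    have hmin := hb ((1 - t) • b + t • β)
    have hexp : l2sq (e - t • z) / (2 * (n : ℝ)) =
        l2sq e / (2 * (n : ℝ)) - t * (e ⬝ᵥ z / n) + t ^ 2 * c := by
      simp only [l2sq_eq_dotProduct, sub_dotProduct, dotProduct_sub, smul_dotProduct,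
        dotProduct_smul, smul_eq_mul, dotProduct_comm z e, hc]
      field_simp
      ring
    rw [hres, hexp] at hmin
    simp only [smul_eq_mul] at hconv
    linarith
  by_contra! hlt
  set a := e ⬝ᵥ z / n - (φ β - φ b) with ha
  have ha0 : 0 < a := by rw [ha]; linarith
  have h := hline (a / (a + c)) (by positivity) (by rw [div_le_one (by positivity)]; linarith)
  have h2 : a / (a + c) * (a + c) = a := by field_simp
  have ht : 0 < a / (a + c) := by positivity
  have h3 : a ≤ a / (a + c) * c := by
    refine le_of_mul_le_mul_left ?_ ht
    linarith
  nlinarith [mul_pos ht ha0]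

lemma IsLassoSol.dotProduct_residual_le {n p : ℕ} (hn : 0 < n) {X : Matrix (Fin n) (Fin p) ℝ}
    {y : Fin n → ℝ} {lam : ℝ} (hlam : 0 < lam) {b : Fin p → ℝ} (hb : IsLassoSol X y lam b)
    (β : Fin p → ℝ) :
    (y - X.mulVec b) ⬝ᵥ X.mulVec (β - b) / n ≤ lam * (l1 β - l1 b) := by
  have h := dotProduct_residual_le_of_isMin hn X y (convexOn_l1.smul hlam.le) hb β
  simpa [mul_sub] using h

lemma sum_lassoSubgrad_mul {n p : ℕ} (X : Matrix (Fin n) (Fin p) ℝ) (y : Fin n → ℝ) (lam : ℝ)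
    (b β : Fin p → ℝ) :
    ∑ j, lassoSubgrad X y lam b j * β j = (y - X.mulVec b) ⬝ᵥ X.mulVec β / (lam * n) := by
  rw [Matrix.dotProduct_mulVec, ← Matrix.mulVec_transpose, dotProduct, sum_div]
  exact sum_congr rfl fun j _ => by rw [lassoSubgrad]; ring

lemma IsBregmanSol.dotProduct_residual_le {n p : ℕ} (hn : 0 < n)
    {X : Matrix (Fin n) (Fin p) ℝ} {y : Fin n → ℝ} {lam1 lam2 : ℝ}
    (hlam2 : 0 < lam2) {bhat b : Fin p → ℝ} (hb : IsBregmanSol X y lam1 lam2 bhat b)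
    (β : Fin p → ℝ) :
    (y - X.mulVec b) ⬝ᵥ X.mulVec (β - b) / n ≤ lam2 * (l1 β - l1 b) -
      lam2 / lam1 * ((y - X.mulVec bhat) ⬝ᵥ X.mulVec (β - b) / n) := by
  have hconv : ConvexOn ℝ Set.univ fun β : Fin p → ℝ =>
      lam2 * (l1 β - ∑ j, lassoSubgrad X y lam1 bhat j * β j) := by
    refine (convexOn_l1.sub ⟨convex_univ, fun x _ y _ a c _ _ _ => ?_⟩).smul hlam2.le
    simp only [smul_eq_mul, mul_sum, ← sum_add_distrib, Pi.add_apply, Pi.smul_apply]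
    exact (sum_congr rfl fun i _ => by ring).le
  refine (dotProduct_residual_le_of_isMin hn X y hconv hb β).trans_eq ?_
  simp only [sum_lassoSubgrad_mul, Matrix.mulVec_sub, dotProduct_sub]
  field_simp
  ring

lemma l1_sub_le_of_support {p : ℕ} (b β : Fin p → ℝ) :
    l1 b - l1 β ≤ ∑ j with b j ≠ 0, |(b - β) j| - ∑ j ∈ (univ.filter fun j => b j ≠ 0)ᶜ,
      |(b - β) j| := by
  rw [l1, l1, ← sum_sub_distrib, ← sum_add_sum_compl (univ.filter fun j => b j ≠ 0)
    (fun j => |b j| - |β j|), sub_eq_add_neg, ← sum_neg_distrib]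
  refine add_le_add (sum_le_sum fun j _ => abs_sub_abs_le_abs_sub _ _) (sum_le_sum fun j hj => ?_)
  have hj0 : b j = 0 := by simpa using hj
  simp [hj0]

/-- Restricted eigenvalues control the cone excess by the prediction loss. -/
lemma RE.cone_excess_le {n p s : ℕ} (hn : 0 < n) {X : Matrix (Fin n) (Fin p) ℝ} {c0 κ : ℝ}
    (hRE : RE X c0 s κ) {J : Finset (Fin p)} (hJ : #J ≤ s) {t : ℝ} (ht : 0 ≤ t)
    (Δ : Fin p → ℝ) :
    t * (c0 * ∑ j ∈ J, |Δ j| - ∑ j ∈ Jᶜ, |Δ j|) ≤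
      l2sq (X.mulVec Δ) / n / 2 + t ^ 2 * c0 ^ 2 * s / (2 * κ ^ 2) := by
  obtain ⟨hκ, hRE⟩ := hRE
  have hn' : (0 : ℝ) < n := Nat.cast_pos.mpr hn
  have hD0 : 0 ≤ l2sq (X.mulVec Δ) / n :=
    div_nonneg (sum_nonneg fun i _ => sq_nonneg _) hn'.le
  have hrem : 0 ≤ t ^ 2 * c0 ^ 2 * s / (2 * κ ^ 2) := by positivity
  have hcompl : 0 ≤ ∑ j ∈ Jᶜ, |Δ j| := sum_nonneg fun j _ => abs_nonneg _
  rcases lt_or_ge (c0 * ∑ j ∈ J, |Δ j|) (∑ j ∈ Jᶜ, |Δ j|) with hlt | hge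
  · have : t * (c0 * ∑ j ∈ J, |Δ j| - ∑ j ∈ Jᶜ, |Δ j|) ≤ 0 :=
      mul_nonpos_of_nonneg_of_nonpos ht (by linarith)
    linarith
  have hD : κ ^ 2 * ∑ j ∈ J, Δ j ^ 2 ≤ l2sq (X.mulVec Δ) / n := by
    rw [le_div_iff₀ hn']
    linarith [hRE J hJ Δ hge]
  have hCS : (∑ j ∈ J, |Δ j|) ^ 2 ≤ s * ∑ j ∈ J, Δ j ^ 2 := by
    refine (sq_sum_le_card_mul_sum_sq (s := J) (f := fun j => |Δ j|)).trans ?_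
    simp only [sq_abs]
    exact mul_le_mul_of_nonneg_right (by exact_mod_cast hJ) (sum_nonneg fun j _ => sq_nonneg _)
  set a := ∑ j ∈ J, |Δ j|
  set q := ∑ j ∈ J, Δ j ^ 2
  have hAG : t * (c0 * a) ≤ κ ^ 2 * q / 2 + t ^ 2 * c0 ^ 2 * s / (2 * κ ^ 2) := by
    have hq : 0 ≤ q := sum_nonneg fun j _ => sq_nonneg _
    have hprod : (t * (c0 * a)) ^ 2 ≤ (κ ^ 2 * q) * (t ^ 2 * c0 ^ 2 * s / κ ^ 2) := by
      calc (t * (c0 * a)) ^ 2 = (t * c0) ^ 2 * a ^ 2 := by ring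
        _ ≤ (t * c0) ^ 2 * (s * q) := by gcongr
        _ = _ := by field_simp
    have hsum : 0 ≤ κ ^ 2 * q / 2 + t ^ 2 * c0 ^ 2 * s / (2 * κ ^ 2) := by positivity
    refine le_of_sq_le_sq ?_ hsum
    have : t ^ 2 * c0 ^ 2 * s / (2 * κ ^ 2) = t ^ 2 * c0 ^ 2 * s / κ ^ 2 / 2 := by
      field_simp
    rw [this]
    nlinarith [sq_nonneg (κ ^ 2 * q - t ^ 2 * c0 ^ 2 * s / κ ^ 2)]
  nlinarith [mul_nonneg ht hcompl]

lemma dotProduct_mulVec_le_l1 {n p : ℕ} (X : Matrix (Fin n) (Fin p) ℝ) {e : Fin n → ℝ} {c : ℝ}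
    (he : ∀ j, |∑ i, X i j * e i| ≤ c) (Δ : Fin p → ℝ) :
    |e ⬝ᵥ X.mulVec Δ| ≤ c * l1 Δ := by
  rw [Matrix.dotProduct_mulVec, ← Matrix.mulVec_transpose, dotProduct, l1, mul_sum]
  refine (abs_sum_le_sum_abs _ _).trans (sum_le_sum fun j _ => ?_)
  rw [abs_mul]
  exact mul_le_mul_of_nonneg_right (he j) (abs_nonneg _)

/-- Joint prediction bound for the Lasso and the Bregman Lasso when the noise is dominated by
the tuning parameter. -/
lemma bregman_prediction_bound {n p s : ℕ} (hn : 0 < n) (X : Matrix (Fin n) (Fin p) ℝ)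
    (bstar : Fin p → ℝ) (hs : #{j | bstar j ≠ 0} = s) {κ3 κ1 : ℝ} (hRE3 : RE X 3 s κ3)
    (hRE1 : RE X 1 s κ1) {lam1 lam2 c : ℝ} (hlam1 : 0 < lam1) (hlam2 : 0 < lam2)
    (hc : (1 + 2 * (lam2 / lam1)) / (lam2 / lam1) * (2 * c) = lam1)
    {ε : Fin n → ℝ} (hε : ∀ j, |∑ i, X i j * ε i| ≤ n * c) {bhat bb : Fin p → ℝ}
    (hbhat : IsLassoSol X (X.mulVec bstar + ε) lam1 bhat)
    (hbb : IsBregmanSol X (X.mulVec bstar + ε) lam1 lam2 bhat bb) :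
    (lam2 / lam1 + 2) / (lam2 / lam1) * (l2sq (X.mulVec (bstar - bb)) / n) +
        l2sq (X.mulVec (bstar - bhat)) / n ≤
      lam1 ^ 2 * s / κ1 ^ 2 + 9 * lam1 ^ 2 * s / (4 * κ3 ^ 2) := by
  have hn' : (0 : ℝ) < n := Nat.cast_pos.mpr hn
  have hL := hbhat.dotProduct_residual_le hn hlam1 bstar
  have hLB := hbhat.dotProduct_residual_le hn hlam1 bb
  have hB := hbb.dotProduct_residual_le hn hlam2 bstar
  have hBL := hbb.dotProduct_residual_le hn hlam2 bhat
  have hnoise : -(ε ⬝ᵥ X.mulVec (bstar - bb) / n) ≤ c * l1 (bstar - bb) := by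
    rw [← neg_div, div_le_iff₀ hn']
    linarith [neg_le_of_abs_le (dotProduct_mulVec_le_l1 X hε (bstar - bb))]
  have hcone3 := hRE3.cone_excess_le hn hs.le (t := lam1 / 2) (by positivity) (bstar - bb)
  have hcone1 := hRE1.cone_excess_le hn hs.le (t := lam1) hlam1.le (bstar - bhat)
  have hsup3 := mul_le_mul_of_nonneg_left (l1_sub_le_of_support bstar bb) hlam1.le
  have hsup1 := mul_le_mul_of_nonneg_left (l1_sub_le_of_support bstar bhat) hlam1.le
  have hl1 : l1 (bstar - bb) = ∑ j with bstar j ≠ 0, |(bstar - bb) j| +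
      ∑ j ∈ (univ.filter fun j => bstar j ≠ 0)ᶜ, |(bstar - bb) j| :=
    (sum_add_sum_compl _ _).symm
  have e3 : (lam1 / 2) ^ 2 * 3 ^ 2 * s / (2 * κ3 ^ 2) = 9 * lam1 ^ 2 * s / (4 * κ3 ^ 2) / 2 := by
    ring
  have e1 : lam1 ^ 2 * 1 ^ 2 * s / (2 * κ1 ^ 2) = lam1 ^ 2 * s / κ1 ^ 2 / 2 := by ring
  rw [e3] at hcone3
  rw [e1] at hcone1
  set r := lam2 / lam1 with hr
  have hr0 : 0 < r := by positivity
  have hlam2r : lam2 = r * lam1 := by rw [hr]; field_simp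
  have hres : ∀ b, X.mulVec bstar + ε - X.mulVec b = X.mulVec (bstar - b) + ε := fun b => by
    rw [Matrix.mulVec_sub]; abel
  have hdiff : ∀ b b', X.mulVec (b - b') = X.mulVec (bstar - b') - X.mulVec (bstar - b) :=
    fun b b' => by rw [← Matrix.mulVec_sub]; congr 1; abel
  rw [hres] at hL
  rw [hres, hdiff bb bhat] at hLB
  rw [hres, hres] at hB
  rw [hres, hres, hdiff bhat bb] at hBL
  rw [l2sq_eq_dotProduct] at hcone3 hcone1 ⊢
  rw [l2sq_eq_dotProduct]
  set u := X.mulVec (bstar - bb)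
  set v := X.mulVec (bstar - bhat)
  rw [hlam2r] at hB hBL
  simp only [add_dotProduct, dotProduct_sub, sub_div, add_div] at hL hLB hB hBL
  rw [dotProduct_comm v u] at hLB hB hBL
  have hc' : (2 + r⁻¹) * c = lam1 / 2 := by
    rw [← hc]
    field_simp
    ring
  have hB' := mul_le_mul_of_nonneg_left hB (inv_pos.mpr hr0).le
  have hLB' := mul_le_mul_of_nonneg_left hLB hr0.le
  have hnoise' := mul_le_mul_of_nonneg_left hnoise (by positivity : 0 ≤ 2 + r⁻¹)
  rw [← mul_assoc, hc', hl1] at hnoise'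
  have hBr : r⁻¹ * (u ⬝ᵥ u / n + ε ⬝ᵥ u / n) ≤
      lam1 * (l1 bstar - l1 bb) - (u ⬝ᵥ v / n + ε ⬝ᵥ u / n) := by
    refine hB'.trans_eq ?_
    field_simp
  have hgoal : (r + 2) / r = 1 + 2 * r⁻¹ := by field_simp
  rw [hgoal]
  linarith

lemma map_pi_gaussianReal_sum_mul {ι : Type*} [Fintype ι] (a : ι → ℝ) (v w : NNReal)
    (hw : (w : ℝ) = (∑ i, a i ^ 2) * v) :
    (Measure.pi fun _ : ι => gaussianReal 0 v).map (fun x => ∑ i, a i * x i) =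
      gaussianReal 0 w := by
  refine Measure.ext_of_charFun (funext fun t => ?_)
  rw [charFun_apply_real, integral_map
    (Measurable.aemeasurable (by fun_prop)) (by fun_prop), charFun_gaussianReal]
  have hprod : ∀ x : ι → ℝ, Complex.exp (t * (∑ i, a i * x i : ℝ) * Complex.I) =
      ∏ i, Complex.exp ((t * a i : ℝ) * x i * Complex.I) := fun x => by
    rw [← Complex.exp_sum]
    push_cast
    rw [mul_sum, sum_mul]
    exact congrArg _ (sum_congr rfl fun i _ => by ring)
  simp_rw [hprod]
  rw [integral_fintype_prod_eq_prod
    (f := fun i (x : ℝ) => Complex.exp ((t * a i : ℝ) * x * Complex.I))]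
  simp_rw [← charFun_apply_real, charFun_gaussianReal]
  rw [← Complex.exp_sum]
  have hw' : (w : ℂ) = (∑ i, (a i : ℂ) ^ 2) * v := by exact_mod_cast congrArg Complex.ofReal hw
  rw [hw']
  congr 1
  push_cast
  simp only [mul_zero, zero_mul, zero_sub, sum_neg_distrib, sum_mul, sum_div]
  exact congrArg _ (sum_congr rfl fun i _ => by ring)

/-- The sharp two-sided Gaussian tail bound. -/
lemma gaussianReal_abs_gt_le {v : NNReal} (hv : v ≠ 0) {t : ℝ} (ht : 0 ≤ t) :
    gaussianReal 0 v {x | t < |x|} ≤ ENNReal.ofReal (Real.exp (-t ^ 2 / (2 * v))) := by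
  have hneg : ∀ a : ℝ, gaussianReal 0 v (Set.Iio (-a)) = gaussianReal 0 v (Set.Ioi a) := fun a => by
    have h := gaussianReal_map_neg (μ := 0) (v := v)
    rw [neg_zero] at h
    conv_lhs => rw [← h, Measure.map_apply measurable_neg measurableSet_Iio]
    congr 1
    ext x
    simp
  have hshift : gaussianReal 0 v (Set.Ioi t) ≤
      ENNReal.ofReal (Real.exp (-t ^ 2 / (2 * v))) * gaussianReal 0 v (Set.Ioi 0) := by
    have h : gaussianReal 0 v (Set.Ioi t) = gaussianReal (-t) v (Set.Ioi 0) := by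
      rw [← zero_sub t, ← gaussianReal_map_sub_const, Measure.map_apply (by fun_prop)
        measurableSet_Ioi]
      congr 1
      ext x
      simp
    rw [h, gaussianReal_apply _ hv, gaussianReal_apply _ hv,
      ← lintegral_const_mul _ (measurable_gaussianPDF _ _)]
    refine setLIntegral_mono (by fun_prop) fun x hx => ?_
    rw [gaussianPDF, gaussianPDF, ← ENNReal.ofReal_mul (Real.exp_pos _).le]
    refine ENNReal.ofReal_le_ofReal ?_
    rw [gaussianPDFReal, gaussianPDFReal, mul_left_comm, ← Real.exp_add, ← add_div]
    have hx' : 0 < x := hx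
    gcongr
    nlinarith
  have hhalf : 2 * gaussianReal 0 v (Set.Ioi 0) ≤ 1 := by
    rw [two_mul]
    nth_rewrite 1 [← hneg 0]
    rw [neg_zero, ← measure_union (by
      rw [Set.disjoint_left]
      intro x hx hx'
      exact lt_asymm (Set.mem_Iio.mp hx) (Set.mem_Ioi.mp hx')) measurableSet_Ioi]
    exact prob_le_one
  calc gaussianReal 0 v {x | t < |x|}
      ≤ gaussianReal 0 v (Set.Iio (-t) ∪ Set.Ioi t) := by
        refine measure_mono fun x hx => ?_
        rcases lt_abs.mp (show t < |x| from hx) with h | h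
        · exact Or.inr h
        · exact Or.inl (by simp only [Set.mem_Iio]; linarith)
    _ ≤ gaussianReal 0 v (Set.Iio (-t)) + gaussianReal 0 v (Set.Ioi t) := measure_union_le _ _
    _ = 2 * gaussianReal 0 v (Set.Ioi t) := by rw [hneg, two_mul]
    _ ≤ 2 * (ENNReal.ofReal (Real.exp (-t ^ 2 / (2 * v))) * gaussianReal 0 v (Set.Ioi 0)) := by
        gcongr
    _ = ENNReal.ofReal (Real.exp (-t ^ 2 / (2 * v))) * (2 * gaussianReal 0 v (Set.Ioi 0)) := by
        ring
    _ ≤ _ := mul_le_of_le_one_right' hhalf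

/-- Simultaneous control of the correlations of Gaussian noise with normalized columns. -/
lemma gaussianVec_correlation_bound {n p : ℕ} (hn : 0 < n) (hp : 0 < p) {σ : ℝ} (hσ : 0 < σ)
    (X : Matrix (Fin n) (Fin p) ℝ) (hX : ∀ j, ∑ i, X i j ^ 2 = (n : ℝ)) {δ : ℝ}
    (hδ : δ ∈ Set.Ioo (0 : ℝ) 1) :
    ENNReal.ofReal (1 - δ) ≤ gaussianVec n σ {ε | ∀ j, |∑ i, X i j * ε i| ≤
      n * (σ * √(2 * Real.log (p / δ) / n))} := by
  have hn' : (0 : ℝ) < n := Nat.cast_pos.mpr hn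
  have hp' : (1 : ℝ) ≤ p := by exact_mod_cast hp
  obtain ⟨hδ0, hδ1⟩ := hδ
  have : IsProbabilityMeasure (gaussianVec n σ) := by unfold gaussianVec; infer_instance
  set c := n * (σ * √(2 * Real.log (p / δ) / n)) with hc
  have hlog : 0 ≤ Real.log (p / δ) := Real.log_nonneg (by rw [le_div_iff₀ hδ0]; linarith)
  set w : NNReal := n * (σ ^ 2).toNNReal with hwdef
  have hw : (w : ℝ) = n * σ ^ 2 := by
    simp [hwdef, Real.coe_toNNReal _ (sq_nonneg σ)]
  have hw0 : w ≠ 0 := by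
    rw [← NNReal.coe_ne_zero, hw]
    positivity
  have htail : ∀ j, gaussianVec n σ {ε | c < |∑ i, X i j * ε i|} ≤ ENNReal.ofReal (δ / p) := by
    intro j
    have hlaw := map_pi_gaussianReal_sum_mul (fun i => X i j) (σ ^ 2).toNNReal w
      (by rw [hX, hw, Real.coe_toNNReal _ (sq_nonneg σ)])
    have hb := gaussianReal_abs_gt_le hw0 (t := c) (by positivity)
    rw [← hlaw, Measure.map_apply (by fun_prop)
      (measurableSet_lt measurable_const (by fun_prop))] at hb
    refine hb.trans_eq (congrArg _ ?_)
    have hexp : -c ^ 2 / (2 * (w : ℝ)) = -Real.log (p / δ) := by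
      rw [hw, hc, mul_pow, mul_pow, Real.sq_sqrt (by positivity)]
      field_simp
    rw [hexp, Real.exp_neg, Real.exp_log (by positivity), inv_div]
  have hmeas : MeasurableSet {ε : Fin n → ℝ | ∀ j, |∑ i, X i j * ε i| ≤ c} := by
    rw [Set.ofPred_forall]
    exact MeasurableSet.iInter fun j => measurableSet_le (by fun_prop) measurable_const
  have hcompl : gaussianVec n σ {ε | ∀ j, |∑ i, X i j * ε i| ≤ c}ᶜ ≤ ENNReal.ofReal δ := by
    have hset : {ε : Fin n → ℝ | ∀ j, |∑ i, X i j * ε i| ≤ c}ᶜ =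
        ⋃ j, {ε | c < |∑ i, X i j * ε i|} := by
      ext ε
      simp
    rw [hset]
    refine (measure_iUnion_fintype_le _ _).trans ((sum_le_sum fun j _ => htail j).trans_eq ?_)
    rw [sum_const, card_univ, Fintype.card_fin, ← ENNReal.ofReal_nsmul, nsmul_eq_mul]
    congr 1
    field_simp
  rw [ENNReal.ofReal_sub _ hδ0.le, ENNReal.ofReal_one, tsub_le_iff_right,
    ← prob_add_prob_compl (μ := gaussianVec n σ) hmeas]
  gcongr

theorem stmt11 (n p s : ℕ) (hn : 0 < n) (hp : 0 < p) (σ : ℝ) (hσ : 0 < σ)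
    (X : Matrix (Fin n) (Fin p) ℝ)
    (hX : ∀ j, ∑ i, (X i j) ^ 2 = (n : ℝ))
    (bstar : Fin p → ℝ)
    (hs : (Finset.univ.filter fun j => bstar j ≠ 0).card = s)
    (κ3 κ1 : ℝ) (hRE3 : RE X 3 s κ3) (hRE1 : RE X 1 s κ1)
    (δ : ℝ) (hδ : δ ∈ Set.Ioo (0 : ℝ) 1)
    (lam1 lam2 r : ℝ) (hlam1pos : 0 < lam1) (hlam2pos : 0 < lam2)
    (hr : r = lam2 / lam1)
    (hlam1 : lam1 = (1 + 2 * r) / r *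
      (2 * σ * Real.sqrt (2 * Real.log ((p : ℝ) / δ) / (n : ℝ)))) :
    ENNReal.ofReal (1 - δ) ≤
      gaussianVec n σ
        {ε | ∀ bhat bb : Fin p → ℝ,
          IsLassoSol X (X.mulVec bstar + ε) lam1 bhat →
          IsBregmanSol X (X.mulVec bstar + ε) lam1 lam2 bhat bb →
          (r + 2) / r * (l2sq (X.mulVec (bstar - bb)) / (n : ℝ)) +
              l2sq (X.mulVec (bstar - bhat)) / (n : ℝ) ≤
            lam1 ^ 2 * (s : ℝ) / κ1 ^ 2 + 9 * lam1 ^ 2 * (s : ℝ) / (4 * κ3 ^ 2)} := by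
  subst hr
  refine (gaussianVec_correlation_bound hn hp hσ X hX hδ).trans (measure_mono ?_)
  intro ε hε bhat bb hbhat hbb
  exact bregman_prediction_bound hn X bstar hs hRE3 hRE1 hlam1pos hlam2pos
    (by rw [← mul_assoc 2 σ, ← hlam1]) hε hbhat hbb
end

section
/- In the orthogonal (denoising) setting where X = I_p, the Bregman Lasso refitting with parameters λ₁, λ₂ > 0 equals the firm-thresholding (MCP) operator: β̂^{λ₁,λ₂} = MCP(y, λ_H, 1 + λ₁/λ₂), where λ_H = (1/λ₁ + 1/λ₂)^{−1}. Explicitly, for each j ∈ [p], β̂^{λ₁,λ₂}_j = (1 + λ₂/λ₁)·sign(y_j)(|y_j| − λ_H)₊ if |y_j| ≤ λ₁, and β̂^{λ₁,λ₂}_j = y_j if |y_j| > λ₁. -/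
open MeasureTheory ProbabilityTheory Finset

/-- Separability: a minimizer of the denoising Bregman objective minimizes each coordinate. -/
lemma denoiseBregObj_coord_min {p : ℕ} {y ρ b : Fin p → ℝ} {lam : ℝ}
    (hb : ∀ β : Fin p → ℝ, denoiseBregObj y ρ lam b ≤ denoiseBregObj y ρ lam β)
    (j : Fin p) (t : ℝ) :
    (1 / 2) * (y j - b j) ^ 2 + lam * (|b j| - ρ j * b j) ≤
      (1 / 2) * (y j - t) ^ 2 + lam * (|t| - ρ j * t) := by
  have obj_eq : ∀ β : Fin p → ℝ, denoiseBregObj y ρ lam β =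
      ∑ i, ((1 / 2) * (y i - β i) ^ 2 + lam * (|β i| - ρ i * β i)) := by
    intro β
    simp only [denoiseBregObj, l2sq, l1, Pi.sub_apply, Finset.sum_add_distrib,
      ← Finset.mul_sum, Finset.sum_sub_distrib]
  have h := hb (Function.update b j t)
  rw [obj_eq, obj_eq, ← Finset.add_sum_erase _ _ (Finset.mem_univ j),
    ← Finset.add_sum_erase _ _ (Finset.mem_univ j)] at h
  have hrest : ∑ i ∈ Finset.univ.erase j, ((1 / 2) * (y i - Function.update b j t i) ^ 2 +
        lam * (|Function.update b j t i| - ρ i * Function.update b j t i)) =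
      ∑ i ∈ Finset.univ.erase j, ((1 / 2) * (y i - b i) ^ 2 + lam * (|b i| - ρ i * b i)) := by
    refine Finset.sum_congr rfl fun i hi => ?_
    rw [Function.update_of_ne (Finset.ne_of_mem_erase hi)]
  rw [hrest, Function.update_self] at h
  linarith

/-- A point satisfying the first-order conditions is the unique scalar minimizer. -/
lemma eq_of_scalar_min {y r lam b m : ℝ}
    (hb : ∀ t : ℝ, (1 / 2) * (y - b) ^ 2 + lam * (|b| - r * b) ≤
      (1 / 2) * (y - t) ^ 2 + lam * (|t| - r * t))
    (h1 : |y + lam * r - m| ≤ lam) (h2 : (y + lam * r - m) * m = lam * |m|) : b = m := by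
  have h := hb m
  have h3 : (y + lam * r - m) * b ≤ lam * |b| :=
    calc (y + lam * r - m) * b ≤ |(y + lam * r - m) * b| := le_abs_self _
      _ = |y + lam * r - m| * |b| := abs_mul _ _
      _ ≤ lam * |b| := mul_le_mul_of_nonneg_right h1 (abs_nonneg _)
  have h4 : (b - m) ^ 2 ≤ 0 := by nlinarith
  exact sub_eq_zero.mp (pow_eq_zero_iff two_ne_zero |>.mp (le_antisymm h4 (sq_nonneg _)))

/-- First-order conditions for soft-thresholding. -/
lemma softThresholding_optimality {z lam : ℝ} (hlam : 0 ≤ lam) :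
    |z - Real.sign z * max (|z| - lam) 0| ≤ lam ∧
      (z - Real.sign z * max (|z| - lam) 0) * (Real.sign z * max (|z| - lam) 0) =
        lam * |Real.sign z * max (|z| - lam) 0| := by
  rcases le_total |z| lam with h | h
  · rw [max_eq_right (by linarith)]
    simpa using h
  · rw [max_eq_left (by linarith)]
    rcases lt_trichotomy z 0 with hz | rfl | hz
    · rw [abs_of_neg hz] at h ⊢
      rw [Real.sign_of_neg hz, abs_of_nonpos (by linarith), abs_of_nonpos (by linarith)]
      constructor <;> linarith
    · simp at h ⊢
      exact hlam
    · rw [abs_of_pos hz] at h ⊢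
      rw [Real.sign_of_pos hz, abs_of_nonneg (by linarith), abs_of_nonneg (by linarith)]
      constructor <;> linarith

lemma Real.sign_mul_of_pos_left {c : ℝ} (hc : 0 < c) (x : ℝ) :
    Real.sign (c * x) = Real.sign x := by
  rcases lt_trichotomy x 0 with hx | rfl | hx
  · rw [Real.sign_of_neg hx, Real.sign_of_neg (mul_neg_of_pos_of_neg hc hx)]
  · simp
  · rw [Real.sign_of_pos hx, Real.sign_of_pos (mul_pos hc hx)]

theorem stmt14 (p : ℕ) (y : Fin p → ℝ) (lam1 lam2 : ℝ)
    (hlam1 : 0 < lam1) (hlam2 : 0 < lam2)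
    (ρ : Fin p → ℝ) (hρ : ρ = fun j => (y j - softThresh y lam1 j) / lam1)
    (lamH : ℝ) (hlamH : lamH = (1 / lam1 + 1 / lam2)⁻¹)
    (b : Fin p → ℝ)
    (hbmin : ∀ β : Fin p → ℝ, denoiseBregObj y ρ lam2 b ≤ denoiseBregObj y ρ lam2 β) :
    b = MCP y lamH (1 + lam1 / lam2) ∧
    ∀ j,
      (|y j| ≤ lam1 →
        b j = (1 + lam2 / lam1) * (Real.sign (y j) * max (|y j| - lamH) 0)) ∧
      (lam1 < |y j| → b j = y j) := by
  have hsmall : ∀ j, |y j| ≤ lam1 →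
      b j = (1 + lam2 / lam1) * (Real.sign (y j) * max (|y j| - lamH) 0) := by
    intro j hj
    have hr : ρ j = y j / lam1 := by
      simp [hρ, softThresh, max_eq_right (sub_nonpos.mpr hj)]
    have hc : 0 < 1 + lam2 / lam1 := by positivity
    have hcH : (1 + lam2 / lam1) * lamH = lam2 := by
      rw [hlamH]; field_simp; ring
    have hz : y j + lam2 * ρ j = (1 + lam2 / lam1) * y j := by rw [hr]; ring
    have hm : (1 + lam2 / lam1) * (Real.sign (y j) * max (|y j| - lamH) 0) =
        Real.sign (y j + lam2 * ρ j) * max (|y j + lam2 * ρ j| - lam2) 0 := by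
      rw [hz, Real.sign_mul_of_pos_left hc, abs_mul, abs_of_pos hc, mul_left_comm,
        mul_max_of_nonneg _ _ hc.le, mul_sub, hcH, mul_zero]
    rw [hm]
    have hopt := softThresholding_optimality (z := y j + lam2 * ρ j) hlam2.le
    exact eq_of_scalar_min (denoiseBregObj_coord_min hbmin j) hopt.1 hopt.2
  have hlarge : ∀ j, lam1 < |y j| → b j = y j := by
    intro j hj
    have hy : y j ≠ 0 := abs_pos.mp (hlam1.trans hj)
    have hr : ρ j = Real.sign (y j) := by
      simp only [hρ, softThresh, max_eq_left (sub_nonneg.mpr hj.le)]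
      rw [div_eq_iff hlam1.ne']
      rcases lt_or_gt_of_ne hy with h | h
      · rw [Real.sign_of_neg h, abs_of_neg h]; ring
      · rw [Real.sign_of_pos h, abs_of_pos h]; ring
    refine eq_of_scalar_min (denoiseBregObj_coord_min hbmin j) ?_ ?_ <;>
      rw [hr, add_sub_cancel_left] <;> rcases lt_or_gt_of_ne hy with h | h
    · simp [Real.sign_of_neg h, abs_of_pos hlam2]
    · simp [Real.sign_of_pos h, abs_of_pos hlam2]
    · rw [Real.sign_of_neg h, abs_of_neg h]; ring
    · rw [Real.sign_of_pos h, abs_of_pos h]; ring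
  refine ⟨?_, fun j => ⟨hsmall j, hlarge j⟩⟩
  have hthr : lamH * (1 + lam1 / lam2) = lam1 := by
    rw [hlamH]; field_simp
  have hfac : (1 + lam1 / lam2) / (1 + lam1 / lam2 - 1) = 1 + lam2 / lam1 := by
    rw [add_sub_cancel_left]; field_simp; ring
  funext j
  simp only [MCP, hthr, hfac]
  split_ifs with h
  · exact hsmall j h
  · exact hlarge j (not_le.mp h)
end

section
/- In the orthogonal (denoising) setting where X = I_p, the k-th Bregman Iteration with parameter λ > 0 is given in closed form by the firm-thresholding operator: for every k ≥ 1, β̂_{k+1} = MCP(y, λ/(k+1), (k+1)/k); explicitly, componentwise, β̂_{k+1,j} = (k+1)·sign(y_j)(|y_j| − λ/(k+1))₊ if |y_j| ≤ λ/k, and β̂_{k+1,j} = y_j if |y_j| > λ/k. -/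
open MeasureTheory ProbabilityTheory Finset

/-- Projection of `z` onto the interval `[-r, r]`. -/
noncomputable def clip (r z : ℝ) : ℝ := max (-r) (min r z)

lemma clip_of_abs_le {r z : ℝ} (h : |z| ≤ r) : clip r z = z := by
  obtain ⟨h1, h2⟩ := abs_le.mp h
  rw [clip, min_eq_right h2, max_eq_right h1]

lemma clip_of_le {r z : ℝ} (hr : 0 ≤ r) (h : r ≤ z) : clip r z = r := by
  rw [clip, min_eq_left h, max_eq_right (by linarith)]

lemma clip_of_le_neg {r z : ℝ} (hr : 0 ≤ r) (h : z ≤ -r) : clip r z = -r := by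
  rw [clip, min_eq_right (by linarith), max_eq_left h]

lemma abs_clip_le {r : ℝ} (hr : 0 ≤ r) (z : ℝ) : |clip r z| ≤ r :=
  abs_le.mpr ⟨le_max_left _ _, max_le (by linarith) (min_le_left _ _)⟩

lemma clip_mul_sub_clip {r : ℝ} (hr : 0 ≤ r) (z : ℝ) :
    clip r z * (z - clip r z) = r * |z - clip r z| := by
  rcases le_total r z with h | h
  · rw [clip_of_le hr h, abs_of_nonneg (by linarith)]
  · rcases le_total z (-r) with h' | h'
    · rw [clip_of_le_neg hr h', abs_of_nonpos (by linarith)]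
      ring
    · rw [clip_of_abs_le (abs_le.mpr ⟨h', h⟩)]
      simp

/-- Adding `y` to the projection of `k * y` and projecting again yields the projection of
`(k + 1) * y`. -/
lemma clip_add_clip_mul {r : ℝ} (hr : 0 < r) (y : ℝ) (k : ℕ) :
    clip r (y + clip r (k * y)) = clip r ((k + 1) * y) := by
  have hk : (0 : ℝ) ≤ k := k.cast_nonneg
  rcases le_total r (k * y) with h | h
  · have hy : 0 ≤ y := by
      by_contra! hy
      nlinarith
    rw [clip_of_le hr.le h, clip_of_le hr.le (by linarith), clip_of_le hr.le (by linarith)]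
  · rcases le_total ((k : ℝ) * y) (-r) with h' | h'
    · have hy : y ≤ 0 := by
        by_contra! hy
        nlinarith
      rw [clip_of_le_neg hr.le h', clip_of_le_neg hr.le (by linarith),
        clip_of_le_neg hr.le (by linarith)]
    · rw [clip_of_abs_le (abs_le.mpr ⟨h', h⟩)]
      congr 1
      ring

/-- The minimizer of the scalar Bregman objective is the soft-thresholding of `y + r * ρ`,
written as `z - clip r z`. -/
lemma eq_sub_clip_of_isMin {r y ρ b : ℝ} (hr : 0 ≤ r)
    (hb : ∀ t : ℝ, 1 / 2 * (y - b) ^ 2 + r * (|b| - ρ * b) ≤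
      1 / 2 * (y - t) ^ 2 + r * (|t| - ρ * t)) :
    b = y + r * ρ - clip r (y + r * ρ) := by
  set z := y + r * ρ with hz
  have h1 := hb (z - clip r z)
  have h2 := clip_mul_sub_clip hr z
  have h3 : clip r z * b ≤ r * |b| :=
    calc clip r z * b ≤ |clip r z * b| := le_abs_self _
      _ = |clip r z| * |b| := abs_mul _ _
      _ ≤ r * |b| := mul_le_mul_of_nonneg_right (abs_clip_le hr z) (abs_nonneg b)
  have hy : y = z - r * ρ := by rw [hz]; ring
  rw [hy] at h1
  have h4 : (b - (z - clip r z)) ^ 2 ≤ 0 := by nlinarith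
  have h5 : b - (z - clip r z) = 0 :=
    pow_eq_zero_iff two_ne_zero |>.mp (le_antisymm h4 (sq_nonneg _))
  linarith

/-- The denoising Bregman objective is separable across coordinates. -/
lemma denoiseBregObj_eq_sum {p : ℕ} (y ρ : Fin p → ℝ) (lam : ℝ) (β : Fin p → ℝ) :
    denoiseBregObj y ρ lam β =
      ∑ j, (1 / 2 * (y j - β j) ^ 2 + lam * (|β j| - ρ j * β j)) := by
  simp only [denoiseBregObj, l2sq, l1, Pi.sub_apply, Finset.sum_add_distrib, Finset.mul_sum,
    ← Finset.sum_sub_distrib]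

/-- A minimizer of the denoising Bregman objective minimizes it coordinatewise. -/
lemma coord_isMin_of_denoiseBregObj_le {p : ℕ} {y ρ b : Fin p → ℝ} {lam : ℝ}
    (hb : ∀ β, denoiseBregObj y ρ lam b ≤ denoiseBregObj y ρ lam β) (j : Fin p) (t : ℝ) :
    1 / 2 * (y j - b j) ^ 2 + lam * (|b j| - ρ j * b j) ≤
      1 / 2 * (y j - t) ^ 2 + lam * (|t| - ρ j * t) := by
  have h := hb (Function.update b j t)
  rw [denoiseBregObj_eq_sum, denoiseBregObj_eq_sum,
    ← Finset.add_sum_erase _ _ (Finset.mem_univ j),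
    ← Finset.add_sum_erase (a := j) Finset.univ
      (fun i => 1 / 2 * (y i - Function.update b j t i) ^ 2 +
        lam * (|Function.update b j t i| - ρ i * Function.update b j t i))
      (Finset.mem_univ j)] at h
  have hrest : ∑ i ∈ Finset.univ.erase j, (1 / 2 * (y i - Function.update b j t i) ^ 2 +
        lam * (|Function.update b j t i| - ρ i * Function.update b j t i)) =
      ∑ i ∈ Finset.univ.erase j, (1 / 2 * (y i - b i) ^ 2 + lam * (|b i| - ρ i * b i)) :=
    Finset.sum_congr rfl fun i hi => by
      rw [Function.update_of_ne (Finset.ne_of_mem_erase hi)]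
  rw [hrest, Function.update_self] at h
  exact le_of_add_le_add_right h

lemma sub_clip_eq_sign_mul {r : ℝ} (hr : 0 < r) (z : ℝ) :
    z - clip r z = Real.sign z * max (|z| - r) 0 := by
  rcases le_total r z with h | h
  · rw [clip_of_le hr.le h, Real.sign_of_pos (by linarith), abs_of_pos (by linarith),
      max_eq_left (by linarith), one_mul]
  · rcases le_total z (-r) with h' | h'
    · rw [clip_of_le_neg hr.le h', Real.sign_of_neg (by linarith), abs_of_neg (by linarith),
        max_eq_left (by linarith)]
      ring
    · have hz := abs_le.mpr ⟨h', h⟩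
      rw [clip_of_abs_le hz, max_eq_right (by linarith)]
      ring

lemma sign_mul_of_pos {c : ℝ} (hc : 0 < c) (y : ℝ) : Real.sign (c * y) = Real.sign y := by
  rcases lt_trichotomy y 0 with h | h | h
  · rw [Real.sign_of_neg h, Real.sign_of_neg (mul_neg_of_pos_of_neg hc h)]
  · simp [h]
  · rw [Real.sign_of_pos h, Real.sign_of_pos (mul_pos hc h)]


theorem stmt16 (p : ℕ) (y : Fin p → ℝ) (lam : ℝ) (hlam : 0 < lam)
    (b ρ : ℕ → Fin p → ℝ) (hb0 : b 0 = 0) (hρ0 : ρ 0 = 0)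
    (hmin : ∀ k : ℕ, ∀ β : Fin p → ℝ,
      denoiseBregObj y (ρ k) lam (b (k + 1)) ≤ denoiseBregObj y (ρ k) lam β)
    (hρ : ∀ k : ℕ, ρ (k + 1) = fun j => ρ k j + 1 / lam * (y j - b (k + 1) j)) :
    ∀ k : ℕ, 1 ≤ k →
      b (k + 1) = MCP y (lam / ((k : ℝ) + 1)) (((k : ℝ) + 1) / (k : ℝ)) ∧
      ∀ j,
        (|y j| ≤ lam / (k : ℝ) →
          b (k + 1) j =
            ((k : ℝ) + 1) * (Real.sign (y j) * max (|y j| - lam / ((k : ℝ) + 1)) 0)) ∧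
        (lam / (k : ℝ) < |y j| → b (k + 1) j = y j) := by
  have hstep : ∀ k j, b (k + 1) j =
      y j + lam * ρ k j - clip lam (y j + lam * ρ k j) := fun k j =>
    eq_sub_clip_of_isMin hlam.le (coord_isMin_of_denoiseBregObj_le (hmin k) j)
  have hrho : ∀ (k : ℕ) j, lam * ρ k j = clip lam (k * y j) := by
    intro k j
    induction k with
    | zero => simp [hρ0, clip_of_abs_le, hlam.le]
    | succ k ih =>
      have h : lam * ρ (k + 1) j = clip lam (y j + lam * ρ k j) := by
        simp only [hρ, hstep]
        field_simp
        ring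
      rw [h, ih, clip_add_clip_mul hlam]
      push_cast
      rfl
  intro k hk
  have hk0 : (0 : ℝ) < k := by exact_mod_cast hk
  have hk1 : (0 : ℝ) < (k : ℝ) + 1 := by linarith
  have hsmall : ∀ j, |y j| ≤ lam / (k : ℝ) → b (k + 1) j =
      ((k : ℝ) + 1) * (Real.sign (y j) * max (|y j| - lam / ((k : ℝ) + 1)) 0) := by
    intro j hj
    have hky : |(k : ℝ) * y j| ≤ lam := by
      rw [abs_mul, abs_of_pos hk0, mul_comm]
      exact (le_div_iff₀ hk0).mp hj
    have hmax : max (((k : ℝ) + 1) * |y j| - lam) 0 =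
        ((k : ℝ) + 1) * max (|y j| - lam / ((k : ℝ) + 1)) 0 := by
      rw [mul_max_of_nonneg _ _ hk1.le, mul_zero, mul_sub, mul_div_cancel₀ _ hk1.ne']
    rw [hstep, hrho, clip_of_abs_le hky,
      show y j + (k : ℝ) * y j = ((k : ℝ) + 1) * y j by ring, sub_clip_eq_sign_mul hlam,
      sign_mul_of_pos hk1, abs_mul, abs_of_pos hk1, hmax]
    ring
  have hlarge : ∀ j, lam / (k : ℝ) < |y j| → b (k + 1) j = y j := by
    intro j hj
    have hky : lam < k * |y j| := by
      rw [mul_comm]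
      exact (div_lt_iff₀ hk0).mp hj
    rw [hstep, hrho]
    rcases le_total 0 (y j) with h | h
    · rw [abs_of_nonneg h] at hky
      rw [clip_of_le hlam.le hky.le, clip_of_le hlam.le (by linarith)]
      ring
    · rw [abs_of_nonpos h] at hky
      rw [clip_of_le_neg hlam.le (by linarith), clip_of_le_neg hlam.le (by linarith)]
      ring
  refine ⟨funext fun j => ?_, fun j => ⟨hsmall j, hlarge j⟩⟩
  have hthr : lam / ((k : ℝ) + 1) * (((k : ℝ) + 1) / k) = lam / k := by
    field_simp
  have hfac : ((k : ℝ) + 1) / k / (((k : ℝ) + 1) / k - 1) = k + 1 := by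
    field_simp
    ring
  rw [MCP, hthr, hfac]
  split_ifs with h
  · exact hsmall j h
  · exact hlarge j (not_le.mp h)
end

section
/- Let β̂^{λ₁} be a Lasso solution with parameter λ₁ > 0, let ρ̂^{λ₁} = (1/(λ₁n))Xᵀ(y − Xβ̂^{λ₁}), and let E = {j ∈ [p] : |ρ̂^{λ₁}_j| = 1} be the equicorrelation set. Then the Sign-Least-Squares Lasso β̃, defined by β̃_{E^c} = 0 and β̃_E ∈ argmin{ (1/2n)‖y − X_E β_E‖₂² : β_E ∈ ℝ^{|E|}, ρ̂^{λ₁}_E ⊙ β_E ≥ 0 }, is a sign-consistent refitting of β̂^{λ₁}: it satisfies ‖y − Xβ̃‖₂ ≤ ‖y − Xβ̂^{λ₁}‖₂ and (1/n)Xᵀ(y − Xβ̂^{λ₁}) ∈ λ₁·sign(β̃). -/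
open MeasureTheory ProbabilityTheory Finset

theorem nonneg_of_forall_mul_add_sq_mul_nonneg {a c : ℝ}
    (h : ∀ s : ℝ, 0 < s → s ≤ 1 → 0 ≤ s * a + s ^ 2 * c) : 0 ≤ a := by
  by_contra! ha
  have hd : 0 < -a + |c| + 1 := by linarith [abs_nonneg c]
  have hs : 0 < -a / (-a + |c| + 1) := div_pos (by linarith) hd
  have hs' : -a / (-a + |c| + 1) * (-a + |c| + 1) = -a := div_mul_cancel₀ _ hd.ne'
  set s := -a / (-a + |c| + 1)
  have h1 : s ≤ 1 := by
    by_contra! hlt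
    nlinarith [abs_nonneg c]
  have h2 := h s hs h1
  have h3 : 0 ≤ a + s * c := by
    by_contra! hlt
    nlinarith
  nlinarith [le_abs_self c]

theorem l2sq_sub_mulVec_add_single {n p : ℕ} (X : Matrix (Fin n) (Fin p) ℝ) (y : Fin n → ℝ)
    (b : Fin p → ℝ) (j : Fin p) (t : ℝ) :
    l2sq (y - X.mulVec (b + Pi.single j t)) =
      l2sq (y - X.mulVec b) - 2 * t * X.transpose.mulVec (y - X.mulVec b) j +
        t ^ 2 * l2sq (X.col j) := by
  rw [show X.transpose.mulVec (y - X.mulVec b) j = ∑ i, X i j * (y - X.mulVec b) i from rfl,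
    Matrix.mulVec_add, Matrix.mulVec_single]
  unfold l2sq
  rw [Finset.mul_sum, Finset.mul_sum, ← Finset.sum_sub_distrib,
    ← Finset.sum_add_distrib]
  refine Finset.sum_congr rfl fun i _ => ?_
  simp
  ring

theorem l1_add_single {m : ℕ} (b : Fin m → ℝ) (j : Fin m) (t : ℝ) :
    l1 (b + Pi.single j t) = l1 b + (|b j + t| - |b j|) := by
  unfold l1
  rw [← Finset.add_sum_erase _ _ (Finset.mem_univ j),
    ← Finset.add_sum_erase _ (fun i => |b i|) (Finset.mem_univ j),
    Finset.sum_congr rfl fun i hi => by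
      rw [Pi.add_apply, Pi.single_eq_of_ne (Finset.ne_of_mem_erase hi), add_zero]]
  simp only [Pi.add_apply, Pi.single_eq_same]
  ring

namespace IsLassoSol

variable {n p : ℕ} {X : Matrix (Fin n) (Fin p) ℝ} {y : Fin n → ℝ} {lam : ℝ} {b : Fin p → ℝ}

theorem coordinate_variation_nonneg (hb : IsLassoSol X y lam b) (j : Fin p) (t : ℝ) :
    0 ≤ -t * (X.transpose.mulVec (y - X.mulVec b) j / n) +
      t ^ 2 * (l2sq (X.col j) / (2 * n)) + lam * (|b j + t| - |b j|) := by
  have h := hb (b + Pi.single j t)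
  rw [lassoObj, lassoObj, l2sq_sub_mulVec_add_single, l1_add_single] at h
  have e : ∀ u v w : ℝ, (u - 2 * t * v + t ^ 2 * w) / (2 * n) =
      u / (2 * n) - t * (v / n) + t ^ 2 * (w / (2 * n)) := fun u v w => by
    rw [add_div, sub_div, mul_assoc, mul_div_mul_left _ _ two_ne_zero, mul_div_assoc,
      mul_div_assoc]
  rw [e] at h
  linarith

theorem abs_correlation_le (hb : IsLassoSol X y lam b) (hlam : 0 < lam) (j : Fin p) :
    |X.transpose.mulVec (y - X.mulVec b) j / n| ≤ lam := by
  have key : ∀ ε : ℝ, |ε| = 1 →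
      ε * (X.transpose.mulVec (y - X.mulVec b) j / n) ≤ lam := fun ε hε => by
    rw [← sub_nonneg]
    refine nonneg_of_forall_mul_add_sq_mul_nonneg (c := l2sq (X.col j) / (2 * n))
      fun s hs _ => ?_
    have h := hb.coordinate_variation_nonneg j (s * ε)
    have hε2 : ε ^ 2 = 1 := by rw [← sq_abs, hε, one_pow]
    rw [mul_pow, hε2] at h
    have habs : |b j + s * ε| - |b j| ≤ s := by
      have := abs_add_le (b j) (s * ε)
      rw [abs_mul, hε, abs_of_pos hs] at this
      linarith
    nlinarith [mul_le_mul_of_nonneg_left habs hlam.le]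
  rw [abs_le]
  constructor
  · linarith [key (-1) (by simp)]
  · linarith [key 1 (by simp)]

theorem mul_correlation_eq (hb : IsLassoSol X y lam b) (j : Fin p) :
    b j * (X.transpose.mulVec (y - X.mulVec b) j / n) = lam * |b j| := by
  have key : ∀ s : ℝ, -1 ≤ s → 0 ≤
      s * (lam * |b j| - b j * (X.transpose.mulVec (y - X.mulVec b) j / n)) +
        s ^ 2 * (b j ^ 2 * (l2sq (X.col j) / (2 * n))) := fun s hs => by
    have h := hb.coordinate_variation_nonneg j (s * b j)
    have habs : |b j + s * b j| = (1 + s) * |b j| := by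
      rw [← one_add_mul, abs_mul, abs_of_nonneg (by linarith)]
    rw [habs] at h
    linarith
  apply le_antisymm
  · rw [← sub_nonneg]
    exact nonneg_of_forall_mul_add_sq_mul_nonneg fun s hs _ => key s (by linarith)
  · rw [← sub_nonneg]
    refine nonneg_of_forall_mul_add_sq_mul_nonneg
      (c := b j ^ 2 * (l2sq (X.col j) / (2 * n))) fun s _ hs => ?_
    linarith [key (-s) (by linarith)]

end IsLassoSol

theorem lassoSubgrad_eq {n p : ℕ} (X : Matrix (Fin n) (Fin p) ℝ) (y : Fin n → ℝ) (lam : ℝ)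
    (b : Fin p → ℝ) (j : Fin p) :
    lassoSubgrad X y lam b j = X.transpose.mulVec (y - X.mulVec b) j / n / lam := by
  rw [lassoSubgrad, div_div, mul_comm lam]

theorem stmt17 (n p : ℕ) (hn : 0 < n) (hp : 0 < p)
    (X : Matrix (Fin n) (Fin p) ℝ) (y : Fin n → ℝ)
    (lam1 : ℝ) (hlam1 : 0 < lam1)
    (bhat : Fin p → ℝ) (hb : IsLassoSol X y lam1 bhat)
    (bbar : Fin p → ℝ) (hsls : IsSLSSol X y lam1 bhat bbar) :
    SignConsistentRefit X y lam1 bhat bbar := by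
  obtain ⟨hsupp, hsign, hmin⟩ := hsls
  have hmul : ∀ j, lassoSubgrad X y lam1 bhat j * bhat j = |bhat j| := fun j => by
    rw [lassoSubgrad_eq, div_mul_eq_mul_div, mul_comm, hb.mul_correlation_eq j,
      mul_div_cancel_left₀ _ hlam1.ne']
  have hcorr : ∀ j, X.transpose.mulVec (y - X.mulVec bhat) j / (n : ℝ) =
      lassoSubgrad X y lam1 bhat j * lam1 := fun j => by
    rw [lassoSubgrad_eq, div_mul_cancel₀ _ hlam1.ne']
  have hunit : ∀ j, bbar j ≠ 0 →
      lassoSubgrad X y lam1 bhat j = 1 ∨ lassoSubgrad X y lam1 bhat j = -1 := fun j hj => by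
    rw [← abs_eq zero_le_one]
    by_contra h
    exact hj (hsupp j h)
  refine ⟨Real.sqrt_le_sqrt (hmin bhat ⟨fun j hj => ?_, fun j => ?_⟩), fun j => ⟨fun h => ?_,
    fun h => ?_, fun _ => hb.abs_correlation_le hlam1 j⟩⟩
  · by_contra h0
    refine hj (mul_right_cancel₀ (abs_ne_zero.mpr h0) ?_)
    rw [← abs_mul, hmul, abs_abs, one_mul]
  · rw [hmul]
    exact abs_nonneg _
  · rcases hunit j h.ne' with h1 | h1
    · rw [hcorr, h1, one_mul]
    · have := hsign j
      rw [h1] at this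
      linarith
  · rcases hunit j h.ne with h1 | h1
    · have := hsign j
      rw [h1] at this
      linarith
    · rw [hcorr, h1, neg_one_mul]
end
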